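/- arXiv:1605.02758 — 4 statements merged into one kernel-verified Lean document; each statement's English description precedes it below -/
import Mathlib

section
/- Let P be a locally finite pocset, let A be a nonempty set of hyperplanes of P, and let ĥ be a hyperplane of P such that A contains at least one hyperplane different from ĥ. Then there exists a hyperplane k̂ ∈ A with k̂ ≠ ĥ such that ĥ and k̂ are A-inseparable, i.e. no hyperplane of A separates ĥ and k̂. -/
/- Pocsets, hyperplanes, admissible equivalence relations, quotients,
   admissible maps, embeddings, resolutions, group actions on pocsets,
   elementary folds and folding sequences. -/

universe u v w

/-- A pocset: a poset with an order-reversing involution `star` such that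
`h ≠ h *` and `h`, `h *` are incomparable. -/
structure Pocset (P : Type u) where
  le : P → P → Prop
  star : P → P
  le_refl : ∀ a, le a a
  le_trans : ∀ {a b c}, le a b → le b c → le a c
  le_antisymm : ∀ {a b}, le a b → le b a → a = b
  star_star : ∀ a, star (star a) = a
  star_antitone : ∀ {a b}, le a b → le (star b) (star a)
  ne_star : ∀ a, a ≠ star a
  not_le_star : ∀ a, ¬ le a (star a)
  not_star_le : ∀ a, ¬ le (star a) a

namespace Pocset

variable {P : Type u} {P' : Type v}

/-- Strict order. -/
def lt (Q : Pocset P) (a b : P) : Prop := Q.le a b ∧ a ≠ b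

/-- The orientations of the hyperplane `ĥ` determined by the halfspace `h`. -/
def orient (Q : Pocset P) (h : P) : Set P := {h, Q.star h}

/-- `k` is an orientation of the same hyperplane as `h`, i.e. `k̂ = ĥ`. -/
def sameHyp (Q : Pocset P) (h k : P) : Prop := k = h ∨ k = Q.star h

/-- The hyperplanes `ĥ` and `k̂` are transverse: they are distinct and no
orientation of `ĥ` is comparable with any orientation of `k̂`. -/
def transverse (Q : Pocset P) (h k : P) : Prop :=
  ¬ Q.sameHyp h k ∧ ∀ a ∈ Q.orient h, ∀ b ∈ Q.orient k, ¬ Q.le a b ∧ ¬ Q.le b a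

/-- Two hyperplanes are disjoint if they are distinct and not transverse. -/
def disjointHyp (Q : Pocset P) (h k : P) : Prop :=
  ¬ Q.sameHyp h k ∧ ¬ Q.transverse h k

/-- The halfspaces `h` and `k` are facing: `h* < k`. -/
def facing (Q : Pocset P) (h k : P) : Prop := Q.lt (Q.star h) k

/-- The halfspaces `h` and `k` are compatible: not `k ≤ h*`. -/
def compatible (Q : Pocset P) (h k : P) : Prop := ¬ Q.le k (Q.star h)

/-- The hyperplane `k̂` separates the hyperplanes `ĥ` and `l̂`: there are
orientations with `a < b < c`. -/
def separates (Q : Pocset P) (k h l : P) : Prop :=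
  ∃ a ∈ Q.orient h, ∃ b ∈ Q.orient k, ∃ c ∈ Q.orient l, Q.lt a b ∧ Q.lt b c

/-- Local finiteness: every interval is finite. -/
def LocallyFinite (Q : Pocset P) : Prop :=
  ∀ a b : P, {c : P | Q.le a c ∧ Q.le c b}.Finite

/-- The equivalence relation induced on hyperplanes by a relation `r` on
halfspaces: `ĥ ∼ k̂` iff `h ∼ k` or `h ∼ k*`. -/
def hypRel (Q : Pocset P) (r : P → P → Prop) (h k : P) : Prop :=
  r h k ∨ r h (Q.star k)

/-- An admissible equivalence relation on a pocset. -/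
structure IsAdmissible (Q : Pocset P) (r : P → P → Prop) : Prop where
  equiv : Equivalence r
  aer1 : ∀ h, ¬ r h (Q.star h)
  aer2 : ∀ h k, r h k → r (Q.star h) (Q.star k)
  aer3 : ∀ h k, Q.transverse h k → ¬ r h k
  aer4 : ∀ h k, Q.hypRel r h k → ¬ Q.sameHyp h k →
    (∀ m, Q.hypRel r h m → ¬ Q.separates m h k) →
    ∀ a ∈ Q.orient h, ∀ b ∈ Q.orient k, Q.facing a b → r a b

/-- The strict quotient relation: `[h] < [k]` iff `[h] ≠ [k]`, every pair of
representatives has disjoint hyperplanes, and `h' < k'` for every pair of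
representatives whose hyperplanes are `([ĥ] ∪ [k̂])`-inseparable. -/
def QuotLT (Q : Pocset P) (r : P → P → Prop) (h k : P) : Prop :=
  ¬ r h k ∧
  (∀ h' k', r h h' → r k k' → Q.disjointHyp h' k') ∧
  (∀ h' k', r h h' → r k k' →
    (∀ m, (Q.hypRel r h m ∨ Q.hypRel r k m) → ¬ Q.separates m h' k') → Q.lt h' k')

/-- The quotient relation: `[h] ≤ [k]` iff `[h] = [k]` or `[h] < [k]`. -/
def QuotLE (Q : Pocset P) (r : P → P → Prop) (h k : P) : Prop :=
  r h k ∨ Q.QuotLT r h k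

/-- Transversality of `[ĥ]` and `[k̂]` in the quotient pocset. -/
def QuotTransverse (Q : Pocset P) (r : P → P → Prop) (h k : P) : Prop :=
  ¬ Q.hypRel r h k ∧
  ∀ a ∈ Q.orient h, ∀ b ∈ Q.orient k, ¬ Q.QuotLE r a b ∧ ¬ Q.QuotLE r b a

/-- `[k̂]` separates `[ĥ]` and `[l̂]` in the quotient pocset. -/
def QuotSeparates (Q : Pocset P) (r : P → P → Prop) (k h l : P) : Prop :=
  ∃ a ∈ Q.orient h, ∃ b ∈ Q.orient k, ∃ c ∈ Q.orient l,
    Q.QuotLT r a b ∧ Q.QuotLT r b c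

/-- `[h]` and `[k]` are facing in the quotient pocset: `[h]* < [k]`. -/
def QuotFacing (Q : Pocset P) (r : P → P → Prop) (h k : P) : Prop :=
  Q.QuotLT r (Q.star h) k

/-- An admissible map of pocsets. -/
structure IsAdmissibleMap (Q : Pocset P) (Q' : Pocset P') (f : P → P') : Prop where
  am1 : ∀ h, f (Q.star h) = Q'.star (f h)
  am2 : ∀ h k, Q.transverse h k → Q'.transverse (f h) (f k)
  am3 : ∀ h k, Q.facing h k → Q'.sameHyp (f h) (f k) →
    (∀ m, Q'.sameHyp (f m) (f h) → ¬ Q.separates m h k) → f h = f k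
  am4 : ∀ h' : P', (∀ m : P, ¬ Q'.sameHyp (f m) h') →
    ∃ b ∈ Q'.orient h', ∀ m : P, Q'.compatible b (f m)

/-- An embedding of pocsets: an injective, order-reflecting admissible map. -/
structure IsPocsetEmbedding (Q : Pocset P) (Q' : Pocset P') (f : P → P') : Prop where
  adm : IsAdmissibleMap Q Q' f
  inj : Function.Injective f
  le_reflect : ∀ h k, Q'.le (f h) (f k) → Q.le h k

/-- The equivalence relation `∼_f` induced by a map `f`. -/
def simRel (f : P → P') : P → P → Prop := fun a b => f a = f b

/-- A resolution of pocsets: an admissible map `f` such that `∼_f` is an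
admissible equivalence relation and the induced map `P/∼_f → P'` is an
embedding of pocsets (stated here on representatives: `quot_am2` and
`quot_am3` are admissibility of the induced map, `le_reflect` is
order-reflection; injectivity of the induced map is automatic, and its
properties (AM1) and (AM4) coincide with those of `f`). -/
structure IsResolution (Q : Pocset P) (Q' : Pocset P') (f : P → P') : Prop where
  adm : IsAdmissibleMap Q Q' f
  aer : Q.IsAdmissible (simRel f)
  quot_am2 : ∀ h k, Q.QuotTransverse (simRel f) h k → Q'.transverse (f h) (f k)
  quot_am3 : ∀ h k, Q.QuotFacing (simRel f) h k → Q'.sameHyp (f h) (f k) →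
    (∀ m, Q'.sameHyp (f m) (f h) → ¬ Q.QuotSeparates (simRel f) m h k) → f h = f k
  le_reflect : ∀ h k, Q'.le (f h) (f k) → Q.QuotLE (simRel f) h k

/-- A group `G` acts (without inversion) on the pocset `Q` by order-preserving
bijections commuting with `star`. -/
structure IsGAction (Q : Pocset P) (G : Type w) [Group G] [MulAction G P] : Prop where
  smul_le : ∀ (g : G) (a b : P), Q.le a b → Q.le (g • a) (g • b)
  smul_star : ∀ (g : G) (a : P), g • Q.star a = Q.star (g • a)
  no_inversion : ∀ (g : G) (a : P), g • a ≠ Q.star a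

/-- `G`-equivariance of a map. -/
def Equivariant (G : Type w) [Group G] [MulAction G P] [MulAction G P']
    (f : P → P') : Prop :=
  ∀ (g : G) (a : P), f (g • a) = g • f a

/-- An elementary foldable pair for a resolution `f`: facing halfspaces with
`f h₁ = f h₂`, whose hyperplanes are `f⁻¹(f(ĥ₁))`-inseparable, such that no
pair of distinct `∼_f`-equivalent hyperplanes both separate `ĥ₁` and `ĥ₂`. -/
def ElemFoldable (Q : Pocset P) (Q' : Pocset P') (f : P → P') (h₁ h₂ : P) : Prop :=
  Q.facing h₁ h₂ ∧ f h₁ = f h₂ ∧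
  (∀ m, Q'.sameHyp (f m) (f h₁) → ¬ Q.separates m h₁ h₂) ∧
  (∀ m m', Q'.sameHyp (f m) (f m') → ¬ Q.sameHyp m m' →
    ¬ (Q.separates m h₁ h₂ ∧ Q.separates m' h₁ h₂))

/-- `r` is the smallest `G`-invariant and `star`-invariant equivalence
relation with `h₁ ∼ h₂`. -/
structure IsFoldRel (Q : Pocset P) (G : Type w) [Group G] [MulAction G P]
    (h₁ h₂ : P) (r : P → P → Prop) : Prop where
  equiv : Equivalence r
  ginv : ∀ (g : G) (a b : P), r a b → r (g • a) (g • b)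
  sinv : ∀ a b, r a b → r (Q.star a) (Q.star b)
  base : r h₁ h₂
  min : ∀ s : P → P → Prop, Equivalence s →
    (∀ (g : G) (a b : P), s a b → s (g • a) (g • b)) →
    (∀ a b, s a b → s (Q.star a) (Q.star b)) → s h₁ h₂ →
    ∀ a b, r a b → s a b

/-- `[h₁]`, `[h₂]` is an elementary foldable pair in the quotient pocset
`P/r` for the resolution induced by `f` on `P/r`. -/
def QuotElemFoldable (Q : Pocset P) (Q' : Pocset P') (f : P → P')
    (r : P → P → Prop) (h₁ h₂ : P) : Prop :=
  Q.QuotFacing r h₁ h₂ ∧ f h₁ = f h₂ ∧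
  (∀ m, Q'.sameHyp (f m) (f h₁) → ¬ Q.QuotSeparates r m h₁ h₂) ∧
  (∀ m m', Q'.sameHyp (f m) (f m') → ¬ Q.hypRel r m m' →
    ¬ (Q.QuotSeparates r m h₁ h₂ ∧ Q.QuotSeparates r m' h₁ h₂))

/-- `r'` is (the pullback to `P` of) the smallest `G`-invariant and
`star`-invariant equivalence relation on `P/r` identifying `[h₁] ∼ [h₂]`,
i.e. the smallest `G`-invariant, `star`-invariant equivalence relation on `P`
containing `r` with `h₁ ∼ h₂`. -/
structure IsFoldStepRel (Q : Pocset P) (G : Type w) [Group G] [MulAction G P]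
    (r : P → P → Prop) (h₁ h₂ : P) (r' : P → P → Prop) : Prop where
  equiv : Equivalence r'
  mono : ∀ a b, r a b → r' a b
  ginv : ∀ (g : G) (a b : P), r' a b → r' (g • a) (g • b)
  sinv : ∀ a b, r' a b → r' (Q.star a) (Q.star b)
  base : r' h₁ h₂
  min : ∀ s : P → P → Prop, Equivalence s → (∀ a b, r a b → s a b) →
    (∀ (g : G) (a b : P), s a b → s (g • a) (g • b)) →
    (∀ a b, s a b → s (Q.star a) (Q.star b)) → s h₁ h₂ →
    ∀ a b, r' a b → s a b

/-- A finite folding sequence `P = P₀ ↝ P₁ ↝ ⋯ ↝ Pₙ` for a `G`-equivariant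
resolution `f : P → P'`, encoded by the sequence of equivalence relations
`rs i` on `P` with `Pᵢ = P / rs i`: `rs 0` is equality, every `rs i` refines
`∼_f`, and each step is an elementary fold (of an elementary foldable pair
for the induced resolution `fᵢ : P/rs i → P'`). -/
def IsFoldingSequence (Q : Pocset P) (Q' : Pocset P') (G : Type w) [Group G]
    [MulAction G P] (f : P → P') (n : ℕ)
    (rs : Fin (n + 1) → (P → P → Prop)) : Prop :=
  (∀ a b : P, rs 0 a b ↔ a = b) ∧
  (∀ (i : Fin (n + 1)) (a b : P), rs i a b → f a = f b) ∧
  (∀ i : Fin n, ∃ h₁ h₂ : P,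
    Q.QuotElemFoldable Q' f (rs i.castSucc) h₁ h₂ ∧
    Q.IsFoldStepRel G (rs i.castSucc) h₁ h₂ (rs i.succ))

end Pocset

namespace Pocset

variable {P : Type u}

/-- The partial order underlying a pocset. -/
abbrev toPartialOrder (Q : Pocset P) : PartialOrder P where
  le := Q.le
  le_refl := Q.le_refl
  le_trans _ _ _ := Q.le_trans
  le_antisymm _ _ := Q.le_antisymm

/-- Every nonempty finite set of halfspaces has a minimal element. -/
theorem exists_minimal_of_finite (Q : Pocset P) {S : Set P} (hS : S.Finite)
    (hne : S.Nonempty) : ∃ k ∈ S, ∀ l ∈ S, Q.le l k → l = k := by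
  let := Q.toPartialOrder
  obtain ⟨k, hk⟩ := hS.exists_minimal hne
  exact ⟨k, hk.prop, fun l hl hlk => Q.le_antisymm hlk (hk.le_of_le hl hlk)⟩

theorem orient_eq_or {Q : Pocset P} {a b h : P} (ha : a ∈ Q.orient h) (hb : b ∈ Q.orient h) :
    b = a ∨ b = Q.star a := by
  rcases ha with rfl | rfl <;> rcases hb with rfl | rfl <;> simp [Q.star_star]

theorem mem_of_mem_orient {Q : Pocset P} {A : Set P} (hAstar : ∀ a ∈ A, Q.star a ∈ A)
    {a b : P} (ha : a ∈ A) (hb : b ∈ Q.orient a) : b ∈ A := by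
  rcases hb with rfl | rfl
  · exact ha
  · exact hAstar _ ha

theorem not_sameHyp_of_lt {Q : Pocset P} {a h k : P} (ha : a ∈ Q.orient h) (hak : Q.lt a k) :
    ¬ Q.sameHyp h k := by
  intro hk
  rcases orient_eq_or ha hk with rfl | rfl
  · exact hak.2 rfl
  · exact Q.not_le_star a hak.1

/-- If `a < k`, the only orientations `a'`, `k'` of `â`, `k̂` with `a' ≤ k'` are `a` and `k`. -/
theorem eq_and_eq_of_lt_of_le {Q : Pocset P} {a k a' k' : P} (hak : Q.lt a k)
    (ha' : a' = a ∨ a' = Q.star a) (hk' : k' = k ∨ k' = Q.star k) (hle : Q.le a' k') :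
    a' = a ∧ k' = k := by
  rcases ha' with rfl | rfl <;> rcases hk' with rfl | rfl
  · exact ⟨rfl, rfl⟩
  · have hka := Q.star_antitone hle
    rw [Q.star_star] at hka
    exact absurd (Q.le_trans hak.1 hka) (Q.not_le_star _)
  · have hka := Q.star_antitone hle
    rw [Q.star_star] at hka
    exact absurd (Q.le_trans hka hak.1) (Q.not_star_le _)
  · have hka := Q.star_antitone hle
    rw [Q.star_star, Q.star_star] at hka
    exact absurd (Q.le_antisymm hak.1 hka) hak.2

end Pocset

/-- In a locally finite pocset, for every nonempty (star-closed)
set of hyperplanes `A` containing a hyperplane different from `ĥ`, there is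
`k̂ ∈ A` distinct from `ĥ` such that no hyperplane of `A` separates `ĥ`
and `k̂`. -/
theorem exists_A_inseparable_hyperplane {P : Type u} (Q : Pocset P)
    (hLF : Q.LocallyFinite)
    (A : Set P) (hA : A.Nonempty) (hAstar : ∀ a ∈ A, Q.star a ∈ A)
    (h : P) (hex : ∃ k ∈ A, ¬ Q.sameHyp h k) :
    ∃ k ∈ A, ¬ Q.sameHyp h k ∧ ∀ m ∈ A, ¬ Q.separates m h k := by
  obtain ⟨k₀, hk₀A, hk₀⟩ := hex
  by_cases hsep : ∀ m ∈ A, ¬ Q.separates m h k₀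
  · exact ⟨k₀, hk₀A, hk₀, hsep⟩
  push Not at hsep
  obtain ⟨m, hmA, a, ha, b, hb, -, -, hab, -⟩ := hsep
  obtain ⟨k, ⟨hkA, hak, hkb⟩, hmin⟩ := Q.exists_minimal_of_finite
    (S := {l | l ∈ A ∧ Q.lt a l ∧ Q.le l b})
    ((hLF a b).subset fun l hl => ⟨hl.2.1.1, hl.2.2⟩)
    ⟨b, Pocset.mem_of_mem_orient hAstar hmA hb, hab, Q.le_refl b⟩
  refine ⟨k, hkA, Pocset.not_sameHyp_of_lt ha hak, ?_⟩
  rintro n hnA ⟨a', ha', l, hl, k', hk', hal, hlk⟩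
  obtain ⟨rfl, rfl⟩ :=
    Pocset.eq_and_eq_of_lt_of_le hak (Pocset.orient_eq_or ha ha') hk' (Q.le_trans hal.1 hlk.1)
  exact hlk.2 (hmin l ⟨Pocset.mem_of_mem_orient hAstar hnA hl, hal, Q.le_trans hlk.1 hkb⟩ hlk.1)
end

section
/- Let (P, ≤, *) be a locally finite pocset and let ∼ be an admissible equivalence relation on P. Then the quotient P/∼, equipped with the quotient involution [h]* = [h*] and the quotient relation, is a locally finite pocset: the quotient relation ≤ is a partial order on P/∼, [h] ↦ [h]* is an order-reversing involution, [h] ≠ [h]* and [h], [h]* are incomparable for every class [h], and every interval {[l] : [h] ≤ [l] ≤ [k]} is finite. -/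
/- Pocsets, hyperplanes, admissible equivalence relations, quotients,
   admissible maps, embeddings, resolutions, group actions on pocsets,
   elementary folds and folding sequences. -/

universe u v w

namespace Pocset

variable {P : Type u} {Q : Pocset P} {r : P → P → Prop} {a b h k l m x y : P}

theorem lt_trans (h₁ : Q.lt a b) (h₂ : Q.lt b m) : Q.lt a m :=
  ⟨Q.le_trans h₁.1 h₂.1, fun e => h₁.2 (Q.le_antisymm h₁.1 (e ▸ h₂.1))⟩

theorem lt_of_le_of_lt (h₁ : Q.le a b) (h₂ : Q.lt b m) : Q.lt a m :=
  ⟨Q.le_trans h₁ h₂.1, fun e => h₂.2 (Q.le_antisymm h₂.1 (e ▸ h₁))⟩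

theorem lt_irrefl : ¬ Q.lt a a := fun h => h.2 rfl

theorem star_lt_star (h₁ : Q.lt a b) : Q.lt (Q.star b) (Q.star a) :=
  ⟨Q.star_antitone h₁.1, fun e => h₁.2 (by rw [← Q.star_star a, ← e, Q.star_star])⟩

theorem lt_of_star_lt_star (h₁ : Q.lt (Q.star a) (Q.star b)) : Q.lt b a := by
  simpa only [Q.star_star] using star_lt_star h₁

theorem lt_star_comm (h₁ : Q.lt a (Q.star b)) : Q.lt b (Q.star a) := by
  simpa only [Q.star_star] using star_lt_star h₁

theorem star_lt_comm (h₁ : Q.lt (Q.star a) b) : Q.lt (Q.star b) a := by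
  simpa only [Q.star_star] using star_lt_star h₁

theorem not_lt_star_of_lt (h₁ : Q.lt a b) : ¬ Q.lt a (Q.star b) := fun h₂ =>
  Q.not_le_star a (lt_trans h₁ (lt_star_comm h₂)).1

theorem not_star_lt_of_lt (h₁ : Q.lt a b) : ¬ Q.lt (Q.star a) b := fun h₂ =>
  Q.not_star_le b (lt_trans (star_lt_comm h₂) h₁).1

theorem not_star_lt_star_of_lt (h₁ : Q.lt a b) : ¬ Q.lt (Q.star a) (Q.star b) := fun h₂ =>
  lt_irrefl (lt_trans h₁ (lt_of_star_lt_star h₂))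

theorem sameHyp.star_right (h₁ : Q.sameHyp x k) : Q.sameHyp x (Q.star k) := by
  rcases h₁ with rfl | rfl
  · exact .inr rfl
  · exact .inl (Q.star_star x)

/-- The hyperplane of `x` lies in the halfspace `k`. -/
def Inside (Q : Pocset P) (x k : P) : Prop := Q.lt x k ∨ Q.lt (Q.star x) k

theorem Inside.star_left (h₁ : Q.Inside x k) : Q.Inside (Q.star x) k := by
  rcases h₁ with h₁ | h₁
  · exact .inr (by rwa [Q.star_star])
  · exact .inl h₁

theorem Inside.mono (h₁ : Q.Inside x m) (h₂ : Q.lt m k) : Q.Inside x k :=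
  h₁.imp (lt_trans · h₂) (lt_trans · h₂)

theorem Inside.not_star (h₁ : Q.Inside x k) : ¬ Q.Inside x (Q.star k) := by
  rintro (h₂ | h₂) <;> rcases h₁ with h₁ | h₁
  · exact not_lt_star_of_lt h₁ h₂
  · exact not_star_lt_star_of_lt h₂ (by rwa [Q.star_star])
  · exact not_star_lt_star_of_lt h₁ h₂
  · exact not_lt_star_of_lt h₁ h₂

theorem Inside.not_sameHyp (h₁ : Q.Inside x k) : ¬ Q.sameHyp x k := by
  rintro (rfl | rfl) <;> rcases h₁ with h₁ | h₁
  · exact lt_irrefl h₁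
  · exact Q.not_star_le _ h₁.1
  · exact Q.not_le_star _ h₁.1
  · exact lt_irrefl h₁

theorem Inside.star_lt (h₁ : Q.Inside x k) (h₂ : Q.Inside k x) : Q.lt (Q.star x) k := by
  rcases h₁ with h₁ | h₁
  · rcases h₂ with h₂ | h₂
    · exact absurd (lt_trans h₁ h₂) lt_irrefl
    · exact star_lt_comm h₂
  · exact h₁

theorem Inside.lt (h₁ : Q.Inside x k) (h₂ : Q.Inside x m) (h₃ : Q.Inside k (Q.star m)) :
    Q.lt m k := by
  rcases h₃ with h₃ | h₃
  · exact absurd (h₂.mono (lt_star_comm h₃)) h₁.not_star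
  · exact lt_of_star_lt_star h₃

theorem Inside.symm (h₁ : Q.Inside x k) : Q.Inside k x ∨ Q.Inside k (Q.star x) := by
  rcases h₁ with h₁ | h₁
  · exact .inr (.inr (star_lt_star h₁))
  · exact .inl (.inr (star_lt_comm h₁))

theorem disjointHyp_iff : Q.disjointHyp x k ↔ Q.Inside x k ∨ Q.Inside x (Q.star k) := by
  constructor
  · rintro ⟨h₁, h₂⟩
    have h₃ : ∃ a ∈ Q.orient x, ∃ b ∈ Q.orient k, Q.le a b ∨ Q.le b a := by
      by_contra! hc
      exact h₂ ⟨h₁, fun a ha b hb => hc a ha b hb⟩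
    have hne : ∀ a ∈ Q.orient x, ∀ b ∈ Q.orient k, a ≠ b := by
      rintro a (rfl | rfl) b (rfl | rfl) e
      · exact h₁ (.inl e.symm)
      · exact h₁ (.inr (by rw [e, Q.star_star]))
      · exact h₁ (.inr e.symm)
      · exact h₁ (.inl (by rw [← Q.star_star k, ← e, Q.star_star]))
    obtain ⟨a, ha, b, hb, hab⟩ := h₃
    have hne := hne a ha b hb
    have h₄ : Q.lt a b ∨ Q.lt (Q.star a) (Q.star b) :=
      hab.imp (fun h => ⟨h, hne⟩) (fun h => star_lt_star ⟨h, hne.symm⟩)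
    rcases ha with rfl | rfl <;> rcases hb with rfl | rfl <;>
      simp only [Inside, Q.star_star] at h₄ ⊢ <;> tauto
  · intro h₁
    refine ⟨?_, fun h₂ => ?_⟩
    · rcases h₁ with h₁ | h₁
      · exact h₁.not_sameHyp
      · exact fun h₂ => h₁.not_sameHyp h₂.star_right
    · have h₃ := h₂.2
      rcases h₁ with (h₁ | h₁) | (h₁ | h₁)
      · exact (h₃ _ (.inl rfl) _ (.inl rfl)).1 h₁.1
      · exact (h₃ _ (.inr rfl) _ (.inl rfl)).1 h₁.1
      · exact (h₃ _ (.inl rfl) _ (.inr rfl)).1 h₁.1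
      · exact (h₃ _ (.inr rfl) _ (.inr rfl)).1 h₁.1

theorem disjointHyp.star_left (h₁ : Q.disjointHyp x k) : Q.disjointHyp (Q.star x) k :=
  disjointHyp_iff.2 ((disjointHyp_iff.1 h₁).imp Inside.star_left Inside.star_left)

theorem disjointHyp.star_right (h₁ : Q.disjointHyp x k) : Q.disjointHyp x (Q.star k) := by
  rw [disjointHyp_iff, Q.star_star]
  exact (disjointHyp_iff.1 h₁).symm

theorem disjointHyp.symm (h₁ : Q.disjointHyp x k) : Q.disjointHyp k x := by
  rcases disjointHyp_iff.1 h₁ with h₁ | h₁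
  · exact disjointHyp_iff.2 h₁.symm
  · exact disjointHyp_iff.2 (h₁.symm.imp (fun h => by simpa only [Q.star_star] using h.star_left)
      (fun h => by simpa only [Q.star_star] using h.star_left))

theorem separates_iff : Q.separates m x y ↔
    (Q.Inside x m ∧ Q.Inside y (Q.star m)) ∨ (Q.Inside x (Q.star m) ∧ Q.Inside y m) := by
  constructor
  · rintro ⟨a, ha, b, hb, c, hc, hab, hbc⟩
    have h₁ : Q.Inside x b := by
      rcases ha with rfl | rfl
      exacts [.inl hab, .inr hab]
    have h₂ : Q.Inside y (Q.star b) := by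
      rcases hc with rfl | rfl
      exacts [.inr (star_lt_star hbc), .inl (lt_star_comm hbc)]
    rcases hb with rfl | rfl
    · exact .inl ⟨h₁, h₂⟩
    · exact .inr ⟨h₁, by rwa [Q.star_star] at h₂⟩
  · have key : ∀ b ∈ Q.orient m, Q.Inside x b → Q.Inside y (Q.star b) → Q.separates m x y := by
      intro b hb h₁ h₂
      obtain ⟨a, ha, hab⟩ : ∃ a ∈ Q.orient x, Q.lt a b := by
        rcases h₁ with h₁ | h₁
        exacts [⟨_, .inl rfl, h₁⟩, ⟨_, .inr rfl, h₁⟩]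
      obtain ⟨c, hc, hbc⟩ : ∃ c ∈ Q.orient y, Q.lt b c := by
        rcases h₂ with h₂ | h₂
        · exact ⟨_, .inr rfl, lt_star_comm h₂⟩
        · exact ⟨_, .inl rfl, lt_of_star_lt_star h₂⟩
      exact ⟨a, ha, b, hb, c, hc, hab, hbc⟩
    rintro (⟨h₁, h₂⟩ | ⟨h₁, h₂⟩)
    · exact key m (.inl rfl) h₁ h₂
    · exact key _ (.inr rfl) h₁ (by rwa [Q.star_star])

theorem separates.symm (h₁ : Q.separates m x y) : Q.separates m y x := by
  rw [separates_iff] at *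
  tauto

theorem separates.disjointHyp (h₁ : Q.separates m x y) : Q.disjointHyp x y := by
  obtain ⟨a, ha, b, -, c, hc, hab, hbc⟩ := h₁
  have h := lt_trans hab hbc
  rw [disjointHyp_iff]
  rcases ha with rfl | rfl <;> rcases hc with rfl | rfl
  exacts [.inl (.inl h), .inr (.inl h), .inl (.inr h), .inr (.inr h)]

theorem separates.star_left (h₁ : Q.separates m x y) : Q.separates m (Q.star x) y := by
  rw [separates_iff] at *
  exact h₁.imp (fun h => ⟨h.1.star_left, h.2⟩) (fun h => ⟨h.1.star_left, h.2⟩)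

theorem separates.of_star_left (h₁ : Q.separates m (Q.star x) y) : Q.separates m x y := by
  simpa only [Q.star_star] using h₁.star_left

theorem separates.of_star_right (h₁ : Q.separates m x (Q.star y)) : Q.separates m x y :=
  h₁.symm.of_star_left.symm

theorem hypRel.star_right (h₁ : Q.hypRel r k m) : Q.hypRel r k (Q.star m) :=
  h₁.symm.imp id (fun h => by rwa [Q.star_star])

/-- `k` is a halfspace containing the hyperplane of `x` which is minimal among the halfspaces
of `[k̂]` with this property. -/
def IsNear (Q : Pocset P) (r : P → P → Prop) (k x : P) : Prop :=
  Q.Inside x k ∧ ∀ m, Q.hypRel r k m → Q.Inside x m → ¬ Q.lt m k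

/-- The class of `k` contains a halfspace bounded by a hyperplane of `[k̂]` nearest to `x`. -/
def NearClass (Q : Pocset P) (r : P → P → Prop) (k x : P) : Prop :=
  ∃ k', r k k' ∧ Q.IsNear r k' x

theorem IsNear.not_separates (h₁ : Q.IsNear r k x) (hm : Q.hypRel r k m) :
    ¬ Q.separates m x k := by
  rw [separates_iff]
  rintro (⟨h₂, h₃⟩ | ⟨h₂, h₃⟩)
  · exact h₁.2 m hm h₂ (h₁.1.lt h₂ h₃)
  · exact h₁.2 _ hm.star_right h₂ (h₁.1.lt h₂ (by rwa [Q.star_star]))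

theorem exists_isNear (hLF : Q.LocallyFinite) (hr : Q.IsAdmissible r) (h₁ : Q.Inside x k) :
    ∃ m, Q.hypRel r k m ∧ Q.le m k ∧ Q.IsNear r m x := by
  let T : Set P := {m | Q.hypRel r k m ∧ Q.le m k ∧ Q.Inside x m}
  have hT : T.Finite := by
    refine ((hLF x k).union (hLF (Q.star x) k)).subset ?_
    rintro m ⟨-, hm, hx | hx⟩
    exacts [.inl ⟨hx.1, hm⟩, .inr ⟨hx.1, hm⟩]
  let _ : PartialOrder P :=
    { le := Q.le
      le_refl := Q.le_refl
      le_trans := fun _ _ _ => Q.le_trans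
      le_antisymm := fun _ _ => Q.le_antisymm }
  obtain ⟨m, hm, hmin⟩ := hT.exists_minimal ⟨k, .inl (hr.equiv.refl k), Q.le_refl k, h₁⟩
  refine ⟨m, hm.1, hm.2.1, hm.2.2, fun n hn hx hlt => ?_⟩
  refine hlt.2 (Q.le_antisymm hlt.1 (hmin ⟨?_, Q.le_trans hlt.1 hm.2.1, hx⟩ hlt.1))
  rcases hm.1 with h₂ | h₂ <;> rcases hn with h₃ | h₃
  · exact .inl (hr.equiv.trans h₂ h₃)
  · exact .inr (hr.equiv.trans h₂ h₃)
  · exact .inr (hr.equiv.trans h₂ (hr.aer2 _ _ h₃))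
  · exact .inl (hr.equiv.trans h₂ (by simpa only [Q.star_star] using hr.aer2 _ _ h₃))

namespace IsAdmissible

theorem rel_star_comm (hr : Q.IsAdmissible r) (h₁ : r (Q.star a) b) : r a (Q.star b) := by
  simpa only [Q.star_star] using hr.aer2 _ _ h₁

theorem hypRel_trans (hr : Q.IsAdmissible r) (h₁ : Q.hypRel r k l) (h₂ : Q.hypRel r l m) :
    Q.hypRel r k m := by
  rcases h₁ with h₁ | h₁
  · exact h₂.imp (hr.equiv.trans h₁) (hr.equiv.trans h₁)
  · exact h₂.symm.imp (fun h => hr.equiv.trans h₁ (by simpa only [Q.star_star] using hr.aer2 _ _ h))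
      (fun h => hr.equiv.trans h₁ (hr.aer2 _ _ h))

theorem hypRel_symm (hr : Q.IsAdmissible r) (h₁ : Q.hypRel r k l) : Q.hypRel r l k := by
  rcases h₁ with h₁ | h₁
  · exact .inl (hr.equiv.symm h₁)
  · exact .inr (hr.rel_star_comm (hr.equiv.symm h₁))

theorem hypRel_star_left (hr : Q.IsAdmissible r) (h₁ : Q.hypRel r k l) :
    Q.hypRel r (Q.star k) l :=
  hr.hypRel_symm (hr.hypRel_symm h₁).star_right

theorem hypRel_self (hr : Q.IsAdmissible r) : Q.hypRel r k k := .inl (hr.equiv.refl k)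

theorem disjointHyp_of_hypRel (hr : Q.IsAdmissible r) (h₁ : Q.hypRel r k m)
    (h₂ : ¬ Q.sameHyp k m) : Q.disjointHyp k m := by
  rcases h₁ with h₁ | h₁
  · exact ⟨h₂, fun h₃ => hr.aer3 _ _ h₃ h₁⟩
  · have h₃ : ¬ Q.sameHyp k (Q.star m) := fun h =>
      h₂ (by simpa only [Q.star_star] using h.star_right)
    have h₄ : Q.disjointHyp k (Q.star m) := ⟨h₃, fun h₃ => hr.aer3 _ _ h₃ h₁⟩
    simpa only [Q.star_star] using h₄.star_right

theorem rel_of_isNear (hr : Q.IsAdmissible r) (hx : ∀ m, Q.hypRel r k m → Q.disjointHyp x m)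
    (hk : Q.IsNear r k x) (hl : Q.IsNear r l x) (hkl : Q.hypRel r k l) : r k l := by
  by_cases hs : Q.sameHyp k l
  · rcases hs with rfl | rfl
    · exact hr.equiv.refl _
    · exact absurd hl.1 hk.1.not_star
  have hlk := hr.hypRel_symm hkl
  have hd := hr.disjointHyp_of_hypRel hkl hs
  have h₁ : Q.Inside k l := (disjointHyp_iff.1 hd).resolve_right
    fun h => hk.2 _ hkl hl.1 (hk.1.lt hl.1 h)
  have h₂ : Q.Inside l k := (disjointHyp_iff.1 hd.symm).resolve_right
    fun h => hl.2 _ hlk hk.1 (hl.1.lt hk.1 h)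
  refine hr.aer4 k l hkl hs (fun m hm hsep => ?_) k (.inl rfl) l (.inl rfl) (h₁.star_lt h₂)
  have h₃ := hk.not_separates hm
  have h₄ := hl.not_separates (hr.hypRel_trans hlk hm)
  have h₅ := disjointHyp_iff.1 (hx m hm)
  rw [separates_iff] at *
  tauto

theorem exists_separating (hr : Q.IsAdmissible r)
    (hx : ∀ m, Q.hypRel r k m → Q.disjointHyp x m)
    (hy : ∀ m, Q.hypRel r k m → Q.disjointHyp y m)
    (h₁ : Q.NearClass r k x) (h₂ : Q.NearClass r (Q.star k) y) :
    ∃ m, Q.hypRel r k m ∧ Q.Inside x m ∧ Q.Inside y (Q.star m) := by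
  obtain ⟨a, hka, hax⟩ := h₁
  obtain ⟨b, hkb, hby⟩ := h₂
  have ha : Q.hypRel r k a := .inl hka
  have hb : Q.hypRel r k b := .inr (hr.rel_star_comm hkb)
  have hab := hr.hypRel_trans (hr.hypRel_symm ha) hb
  by_contra! hc
  have hya : Q.Inside y a := (disjointHyp_iff.1 (hy a ha)).resolve_right (hc a ha hax.1)
  have hay : Q.IsNear r a y := by
    refine ⟨hya, fun m hm hym hlt => ?_⟩
    have hkm := hr.hypRel_trans ha hm
    rcases disjointHyp_iff.1 (hx m hkm) with h | h
    · exact hax.2 m hm h hlt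
    · exact hc _ hkm.star_right h (by rwa [Q.star_star])
  have hr' := hr.rel_of_isNear (fun m hm => hy m (hr.hypRel_trans ha hm)) hay hby hab
  exact hr.aer1 k (hr.equiv.trans (hr.equiv.trans hka hr') (hr.equiv.symm hkb))

end IsAdmissible

theorem QuotLT.disjointHyp (h₁ : Q.QuotLT r h k)
    (hx : Q.hypRel r h x) (hy : Q.hypRel r k y) : Q.disjointHyp x y := by
  rcases hx with hx | hx <;> rcases hy with hy | hy
  · exact h₁.2.1 _ _ hx hy
  · simpa only [Q.star_star] using (h₁.2.1 _ _ hx hy).star_right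
  · simpa only [Q.star_star] using (h₁.2.1 _ _ hx hy).star_left
  · simpa only [Q.star_star] using (h₁.2.1 _ _ hx hy).star_left.star_right

theorem QuotLT.star (hr : Q.IsAdmissible r) (h₁ : Q.QuotLT r h k) :
    Q.QuotLT r (Q.star k) (Q.star h) := by
  refine ⟨fun h₂ => h₁.1 ?_, fun x y hx hy => ?_, fun x y hx hy hsep => ?_⟩
  · simpa only [Q.star_star] using hr.equiv.symm (hr.aer2 _ _ h₂)
  · exact (h₁.disjointHyp (.inr (hr.rel_star_comm hy)) (.inr (hr.rel_star_comm hx))).symm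
  · refine lt_of_star_lt_star (h₁.2.2 _ _ (hr.rel_star_comm hy) (hr.rel_star_comm hx) ?_)
    exact fun m hm hs => hsep m (hm.symm.imp hr.hypRel_star_left hr.hypRel_star_left)
      hs.of_star_left.of_star_right.symm

theorem QuotLT.nearClass (hLF : Q.LocallyFinite) (hr : Q.IsAdmissible r) (h₁ : Q.QuotLT r h k)
    (hx : Q.hypRel r h x) : Q.NearClass r k x := by
  obtain ⟨k', hk', hxk'⟩ : ∃ k', Q.hypRel r k k' ∧ Q.Inside x k' := by
    rcases disjointHyp_iff.1 (h₁.disjointHyp hx hr.hypRel_self) with h | h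
    exacts [⟨_, hr.hypRel_self, h⟩, ⟨_, hr.hypRel_self.star_right, h⟩]
  obtain ⟨k₁, hk₁', -, hk₁⟩ := exists_isNear hLF hr hxk'
  replace hk₁' := hr.hypRel_trans hk' hk₁'
  refine ⟨k₁, ?_, hk₁⟩
  obtain ⟨h', hh', hk₁h', hh'k₁, hnear⟩ : ∃ h', Q.hypRel r h h' ∧ Q.Inside k₁ h' ∧
      Q.Inside h' k₁ ∧ ∀ m, Q.Inside h' m → Q.Inside x m := by
    rcases hk₁.1.symm with h | h
    · exact ⟨x, hx, h, hk₁.1, fun _ => id⟩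
    · exact ⟨_, hx.star_right, h, hk₁.1.star_left,
        fun m hm => by simpa only [Q.star_star] using hm.star_left⟩
  have hface := hh'k₁.star_lt hk₁h'
  obtain ⟨h₀, hh₀', hle, hh₀⟩ := exists_isNear hLF hr hk₁h'
  replace hh₀' := hr.hypRel_trans hh' hh₀'
  have hin : Q.Inside h₀ k₁ := by
    refine (disjointHyp_iff.1 (h₁.disjointHyp hh₀' hk₁')).resolve_right ?_
    rintro (h₂ | h₂)
    · rcases hh₀.1 with h₃ | h₃
      · exact not_lt_star_of_lt h₃ (lt_star_comm h₂)
      · exact lt_irrefl (lt_trans h₂ h₃)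
    · exact Q.not_star_le _ (Q.le_trans (lt_trans hface (lt_of_star_lt_star h₂)).1 hle)
  have hface' := hin.star_lt hh₀.1
  have hk₁h₀ : Q.IsNear r k₁ h₀ := by
    refine ⟨hin, fun m hm hh₀m hlt => ?_⟩
    rcases hh₀m with h₂ | h₂
    · exact not_star_lt_of_lt (lt_trans h₂ hlt) hface'
    · exact hk₁.2 m hm (hnear m (.inr (lt_of_le_of_lt (Q.star_antitone hle) h₂))) hlt
  have hsep : ∀ m, Q.hypRel r h m ∨ Q.hypRel r k m → ¬ Q.separates m h₀ k₁ := by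
    rintro m (hm | hm) hs
    · exact hh₀.not_separates (hr.hypRel_trans (hr.hypRel_symm hh₀') hm) hs.symm
    · exact hk₁h₀.not_separates (hr.hypRel_trans (hr.hypRel_symm hk₁') hm) hs
  refine hk₁'.resolve_right fun hk => ?_
  rcases hh₀' with hh | hh
  · have h₂ := h₁.2.2 _ _ hh hk fun m hm hs => hsep m hm hs.of_star_right
    exact lt_irrefl (lt_trans h₂ (star_lt_comm hface'))
  · have h₂ := h₁.2.2 _ _ hh hk fun m hm hs => hsep m hm hs.of_star_left.of_star_right
    exact not_lt_star_of_lt hface' h₂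

theorem NearClass.inside (hr : Q.IsAdmissible r) (hx : ∀ m, Q.hypRel r k m → Q.disjointHyp x m)
    (h₁ : Q.NearClass r k x) (hl : r k l) (hsep : ∀ m, Q.hypRel r k m → ¬ Q.separates m x l) :
    Q.Inside x l := by
  refine (disjointHyp_iff.1 (hx l (.inl hl))).resolve_right fun h₂ => ?_
  obtain ⟨k', hk', hnear⟩ := h₁
  have hkl : Q.hypRel r k (Q.star l) := hypRel.star_right (.inl hl)
  have h₃ : Q.IsNear r (Q.star l) x := by
    refine ⟨h₂, fun m hm hxm hlt => hsep m (hr.hypRel_trans hkl hm) ?_⟩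
    exact separates_iff.2 (.inl ⟨hxm, .inl (lt_star_comm hlt)⟩)
  have h₄ := hr.rel_of_isNear (fun m hm => hx m (hr.hypRel_trans (.inl hk') hm)) hnear h₃
    (hr.hypRel_trans (hr.hypRel_symm (.inl hk')) hkl)
  exact hr.aer1 l (hr.equiv.trans (hr.equiv.symm hl) (hr.equiv.trans hk' h₄))

theorem quotLT_of_nearClass (hr : Q.IsAdmissible r)
    (hd : ∀ x y, Q.hypRel r h x → Q.hypRel r k y → Q.disjointHyp x y)
    (h₁ : ∀ x, Q.hypRel r h x → Q.NearClass r k x)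
    (h₂ : ∀ y, Q.hypRel r k y → Q.NearClass r (Q.star h) y) : Q.QuotLT r h k := by
  refine ⟨fun hhk => (hd k k (.inl hhk) hr.hypRel_self).1 (.inl rfl),
    fun x y hx hy => hd x y (.inl hx) (.inl hy), fun x y hx hy hsep => ?_⟩
  have h₃ : Q.Inside x y := (h₁ x (.inl hx)).inside hr (fun m => hd x m (.inl hx)) hy
    fun m hm => hsep m (.inr hm)
  have h₄ : Q.Inside y (Q.star x) := by
    have hm' : ∀ m, Q.hypRel r (Q.star h) m → Q.hypRel r h m := fun m hm => by
      simpa only [Q.star_star] using hr.hypRel_star_left hm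
    refine (h₂ y (.inl hy)).inside hr (fun m hm => (hd m y (hm' m hm) (.inl hy)).symm)
      (hr.aer2 _ _ hx) fun m hm hs => hsep m (.inl (hm' m hm)) hs.of_star_right.symm
  simpa only [Q.star_star] using h₃.star_left.star_lt h₄

theorem QuotLT.exists_separating (hLF : Q.LocallyFinite) (hr : Q.IsAdmissible r)
    (h₁ : Q.QuotLT r h k) (h₂ : Q.QuotLT r k l) (hx : Q.hypRel r h x) (hy : Q.hypRel r l y) :
    ∃ m, Q.hypRel r k m ∧ Q.Inside x m ∧ Q.Inside y (Q.star m) :=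
  hr.exists_separating (fun _ hm => h₁.disjointHyp hx hm)
    (fun _ hm => (h₂.disjointHyp hm hy).symm) (h₁.nearClass hLF hr hx)
    ((h₂.star hr).nearClass hLF hr (hr.hypRel_star_left hy))

theorem QuotLT.disjointHyp_trans (hLF : Q.LocallyFinite) (hr : Q.IsAdmissible r)
    (h₁ : Q.QuotLT r h k) (h₂ : Q.QuotLT r k l) (hx : Q.hypRel r h x) (hy : Q.hypRel r l y) :
    Q.disjointHyp x y := by
  obtain ⟨m, -, hm⟩ := h₁.exists_separating hLF hr h₂ hx hy
  exact (separates_iff.2 (.inl hm)).disjointHyp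

theorem QuotLT.nearClass_trans (hLF : Q.LocallyFinite) (hr : Q.IsAdmissible r)
    (h₁ : Q.QuotLT r h k) (h₂ : Q.QuotLT r k l) (hx : Q.hypRel r h x) : Q.NearClass r l x := by
  obtain ⟨l', hl', hxl'⟩ : ∃ l', Q.hypRel r l l' ∧ Q.Inside x l' := by
    rcases disjointHyp_iff.1 (h₁.disjointHyp_trans hLF hr h₂ hx hr.hypRel_self) with h | h
    exacts [⟨_, hr.hypRel_self, h⟩, ⟨_, hr.hypRel_self.star_right, h⟩]
  obtain ⟨l₁, hl₁', -, hl₁⟩ := exists_isNear hLF hr hxl'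
  replace hl₁' := hr.hypRel_trans hl' hl₁'
  refine ⟨l₁, ?_, hl₁⟩
  obtain ⟨m, hm, hxm, hl₁m⟩ := h₁.exists_separating hLF hr h₂ hx hl₁'
  have hlt := hl₁.1.lt hxm hl₁m
  have hml₁ : Q.IsNear r l₁ m := by
    refine ⟨.inl hlt, fun n hn hmn hnl => ?_⟩
    rcases hmn with hmn | hmn
    · exact hl₁.2 n hn (hxm.mono hmn) hnl
    · exact not_star_lt_of_lt hlt (lt_trans hmn hnl)
  obtain ⟨l₂, hl₂, hml₂⟩ := h₂.nearClass hLF hr hm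
  have hl₂' : Q.hypRel r l l₂ := .inl hl₂
  exact hr.equiv.trans hl₂ (hr.rel_of_isNear
    (fun n hn => h₂.disjointHyp hm (hr.hypRel_trans hl₂' hn)) hml₂ hml₁
    (hr.hypRel_trans (hr.hypRel_symm hl₂') hl₁'))

theorem QuotLT.trans (hLF : Q.LocallyFinite) (hr : Q.IsAdmissible r)
    (h₁ : Q.QuotLT r h k) (h₂ : Q.QuotLT r k l) : Q.QuotLT r h l :=
  quotLT_of_nearClass hr (fun _ _ => h₁.disjointHyp_trans hLF hr h₂)
    (fun _ => h₁.nearClass_trans hLF hr h₂)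
    (fun _ hy => (h₂.star hr).nearClass_trans hLF hr (h₁.star hr) (hr.hypRel_star_left hy))

theorem QuotLT.congr (hr : Q.IsAdmissible r) (hx : r h x) (hy : r k y) (h₁ : Q.QuotLT r h k) :
    Q.QuotLT r x y := by
  refine ⟨fun h₂ => h₁.1 (hr.equiv.trans hx (hr.equiv.trans h₂ (hr.equiv.symm hy))),
    fun a b ha hb => h₁.2.1 a b (hr.equiv.trans hx ha) (hr.equiv.trans hy hb),
    fun a b ha hb hsep => h₁.2.2 a b (hr.equiv.trans hx ha) (hr.equiv.trans hy hb) ?_⟩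
  exact fun m hm => hsep m (hm.imp (hr.hypRel_trans (.inl (hr.equiv.symm hx)))
    (hr.hypRel_trans (.inl (hr.equiv.symm hy))))

theorem QuotLE.congr (hr : Q.IsAdmissible r) (hx : r h x) (hy : r k y) (h₁ : Q.QuotLE r h k) :
    Q.QuotLE r x y :=
  h₁.imp (fun h₂ => hr.equiv.trans (hr.equiv.symm hx) (hr.equiv.trans h₂ hy))
    (QuotLT.congr hr hx hy)

theorem QuotLE.trans (hLF : Q.LocallyFinite) (hr : Q.IsAdmissible r)
    (h₁ : Q.QuotLE r h k) (h₂ : Q.QuotLE r k l) : Q.QuotLE r h l := by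
  rcases h₁ with h₁ | h₁
  · exact h₂.congr hr (hr.equiv.symm h₁) (hr.equiv.refl l)
  rcases h₂ with h₂ | h₂
  · exact .inr (h₁.congr hr (hr.equiv.refl h) h₂)
  · exact .inr (h₁.trans hLF hr h₂)

theorem QuotLE.antisymm (hLF : Q.LocallyFinite) (hr : Q.IsAdmissible r)
    (h₁ : Q.QuotLE r h k) (h₂ : Q.QuotLE r k h) : r h k := by
  rcases h₁ with h₁ | h₁
  · exact h₁
  rcases h₂ with h₂ | h₂
  · exact hr.equiv.symm h₂
  · exact absurd (hr.equiv.refl h) (h₁.trans hLF hr h₂).1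

theorem QuotLE.star (hr : Q.IsAdmissible r) (h₁ : Q.QuotLE r h k) :
    Q.QuotLE r (Q.star k) (Q.star h) :=
  h₁.imp (fun h₂ => hr.equiv.symm (hr.aer2 _ _ h₂)) (QuotLT.star hr)

theorem not_quotLE_star (hr : Q.IsAdmissible r) : ¬ Q.QuotLE r h (Q.star h) := by
  rintro (h₁ | h₁)
  · exact hr.aer1 h h₁
  · exact (h₁.2.1 _ _ (hr.equiv.refl _) (hr.equiv.refl _)).1 (.inr rfl)

theorem finite_quot_Icc (hLF : Q.LocallyFinite) (hr : Q.IsAdmissible r) (h k : P) :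
    {C : Set P | ∃ l, Q.QuotLE r h l ∧ Q.QuotLE r l k ∧ C = {x | r l x}}.Finite := by
  let F : Set P := ⋃ a ∈ Q.orient h, ⋃ c ∈ Q.orient k, {m | Q.le a m ∧ Q.le m c}
  have hF : F.Finite := ((Set.toFinite _).biUnion fun a _ => (Set.toFinite _).biUnion fun c _ =>
    hLF a c : ((⋃ a ∈ ({h, Q.star h} : Set P), ⋃ c ∈ ({k, Q.star k} : Set P),
      {m | Q.le a m ∧ Q.le m c}) : Set P).Finite)
  have hG : ({h, k} ∪ (F ∪ Q.star '' F)).Finite := (Set.toFinite _).union (hF.union (hF.image _))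
  have hclass : ∀ {l m}, r l m → {x | r m x} = {x | r l x} := fun {l m} hlm => Set.ext fun x =>
    ⟨hr.equiv.trans hlm, hr.equiv.trans (hr.equiv.symm hlm)⟩
  refine (hG.image fun m => {x | r m x}).subset ?_
  rintro C ⟨l, h₁ | h₁, h₂ | h₂, rfl⟩
  · exact ⟨h, .inl (.inl rfl), hclass (hr.equiv.symm h₁)⟩
  · exact ⟨h, .inl (.inl rfl), hclass (hr.equiv.symm h₁)⟩
  · exact ⟨k, .inl (.inr rfl), hclass h₂⟩
  · obtain ⟨m, hm, hsep⟩ := h₁.exists_separating hLF hr h₂ hr.hypRel_self hr.hypRel_self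
    obtain ⟨a, ha, b, hb, c, hc, hab, hbc⟩ := separates_iff.2 (.inl hsep)
    have hbF : b ∈ F := Set.mem_biUnion ha (Set.mem_biUnion hc ⟨hab.1, hbc.1⟩)
    have hlb : Q.hypRel r l b := by
      rcases hb with rfl | rfl
      exacts [hm, hm.star_right]
    rcases hlb with hlb | hlb
    · exact ⟨b, .inr (.inl hbF), hclass hlb⟩
    · exact ⟨_, .inr (.inr ⟨b, hbF, rfl⟩), hclass hlb⟩

end Pocset

/-- The quotient of a locally finite pocset by an admissible
equivalence relation is a locally finite pocset (stated on representatives):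
the quotient relation is reflexive, antisymmetric and transitive on classes,
well defined on classes, the induced involution is order reversing,
`[h] ≠ [h]*`, `[h]` and `[h]*` are incomparable, and intervals of classes
are finite. -/
theorem quotient_is_locally_finite_pocset {P : Type u} (Q : Pocset P)
    (hLF : Q.LocallyFinite) (r : P → P → Prop) (hr : Q.IsAdmissible r) :
    (∀ h, Q.QuotLE r h h) ∧
    (∀ h k, Q.QuotLE r h k → Q.QuotLE r k h → r h k) ∧
    (∀ h k l, Q.QuotLE r h k → Q.QuotLE r k l → Q.QuotLE r h l) ∧
    (∀ h h' k k', r h h' → r k k' → Q.QuotLE r h k → Q.QuotLE r h' k') ∧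
    (∀ h k, Q.QuotLE r h k → Q.QuotLE r (Q.star k) (Q.star h)) ∧
    (∀ h, ¬ r h (Q.star h)) ∧
    (∀ h, ¬ Q.QuotLE r h (Q.star h) ∧ ¬ Q.QuotLE r (Q.star h) h) ∧
    (∀ h k,
      {C : Set P | ∃ l, Q.QuotLE r h l ∧ Q.QuotLE r l k ∧ C = {x | r l x}}.Finite) := by
  exact ⟨fun h => .inl (hr.equiv.refl h), fun _ _ => Pocset.QuotLE.antisymm hLF hr,
    fun _ _ _ => .trans hLF hr, fun _ _ _ _ => .congr hr, fun _ _ => .star hr, hr.aer1,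
    fun h => ⟨Pocset.not_quotLE_star hr, fun h₁ => Pocset.not_quotLE_star hr
      (h := Q.star h) (by rwa [Q.star_star])⟩, Pocset.finite_quot_Icc hLF hr⟩
end

section
/- Let P be a locally finite pocset, let ∼ be an admissible equivalence relation on P, and let h, k ∈ P satisfy [h] < [k] in the quotient P/∼. Then: (i) if the hyperplanes ĥ and k̂ are [k̂]-inseparable, then some orientation of ĥ is strictly smaller than k (i.e. ĥ is contained in the halfspace k); (ii) if ĥ and k̂ are [ĥ]-inseparable, then some orientation of k̂ is strictly smaller than h* (i.e. k̂ is contained in the halfspace h*). -/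
/- Pocsets, hyperplanes, admissible equivalence relations, quotients,
   admissible maps, embeddings, resolutions, group actions on pocsets,
   elementary folds and folding sequences. -/

universe u v w

namespace Pocset

variable {P : Type u} {Q : Pocset P} {r : P → P → Prop}

theorem mem_orient_self (h : P) : h ∈ Q.orient h := Or.inl rfl

theorem orient_star (h : P) : Q.orient (Q.star h) = Q.orient h := by
  ext a
  simp only [orient, Q.star_star, Set.mem_insert_iff, Set.mem_singleton_iff]
  exact or_comm

theorem star_mem_orient {a h : P} (ha : a ∈ Q.orient h) : Q.star a ∈ Q.orient h := by
  rcases ha with rfl | rfl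
  · exact Or.inr rfl
  · exact Or.inl (Q.star_star h)

theorem orient_eq_of_mem {a h : P} (ha : a ∈ Q.orient h) : Q.orient a = Q.orient h := by
  rcases ha with rfl | rfl
  · rfl
  · exact orient_star h

theorem lt_star {a b : P} (hab : Q.lt a b) : Q.lt (Q.star b) (Q.star a) :=
  ⟨Q.star_antitone hab.1, fun e => hab.2 (by rw [← Q.star_star a, ← e, Q.star_star])⟩

theorem lt_trans_s2 {a b c : P} (hab : Q.lt a b) (hbc : Q.lt b c) : Q.lt a c :=
  ⟨Q.le_trans hab.1 hbc.1, fun e => hab.2 (Q.le_antisymm hab.1 (e ▸ hbc.1))⟩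

theorem lt_of_lt_of_le {a b c : P} (hab : Q.lt a b) (hbc : Q.le b c) : Q.lt a c :=
  ⟨Q.le_trans hab.1 hbc, fun e => hab.2 (Q.le_antisymm hab.1 (e ▸ hbc))⟩

theorem not_lt_of_lt {a b : P} (hab : Q.lt a b) : ¬ Q.lt b a :=
  fun hba => (lt_trans_s2 hab hba).2 rfl

theorem separates_symm {m h k : P} (hs : Q.separates m h k) : Q.separates m k h := by
  obtain ⟨a, ha, b, hb, c, hc, hab, hbc⟩ := hs
  exact ⟨_, star_mem_orient hc, _, star_mem_orient hb, _, star_mem_orient ha,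
    lt_star hbc, lt_star hab⟩

theorem separates_of_mem {m h k a c : P} (ha : a ∈ Q.orient h) (hc : c ∈ Q.orient k) :
    Q.separates m a c ↔ Q.separates m h k := by
  simp only [separates, orient_eq_of_mem ha, orient_eq_of_mem hc]

theorem separates_star_comm {m h k : P} :
    Q.separates m (Q.star k) (Q.star h) ↔ Q.separates m h k :=
  (separates_of_mem (Or.inr rfl) (Or.inr rfl)).trans ⟨separates_symm, separates_symm⟩

/-- A hyperplane separating the nested halfspaces `x < y` has an orientation strictly
between them. -/
theorem exists_between_of_separates {n x y : P} (hxy : Q.lt x y) (hs : Q.separates n y x) :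
    ∃ q ∈ Q.orient n, Q.lt x q ∧ Q.lt q y := by
  obtain ⟨p, hp, q, hq, s, hs, hpq, hqs⟩ := hs
  have hps := lt_trans_s2 hpq hqs
  rcases hp with rfl | rfl <;> rcases hs with rfl | rfl
  · exact absurd hxy (not_lt_of_lt hps)
  · exact absurd (lt_trans_s2 hxy hps).1 (Q.not_le_star _)
  · exact absurd (lt_trans_s2 hps hxy).1 (Q.not_star_le _)
  · refine ⟨Q.star q, star_mem_orient hq, ?_, ?_⟩
    · simpa only [Q.star_star] using lt_star hqs
    · simpa only [Q.star_star] using lt_star hpq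

theorem LocallyFinite.exists_minimal_gt (hLF : Q.LocallyFinite) (S : P → Prop) {x a : P}
    (hxa : Q.lt x a) (ha : S a) :
    ∃ m, S m ∧ Q.lt x m ∧ Q.le m a ∧ ∀ q, S q → Q.lt x q → ¬ Q.lt q m := by
  let _ : PartialOrder P :=
    { le := Q.le
      le_refl := Q.le_refl
      le_trans := fun _ _ _ => Q.le_trans
      le_antisymm := fun _ _ => Q.le_antisymm }
  have hfin : {c | S c ∧ Q.lt x c ∧ Q.le c a}.Finite :=
    (hLF x a).subset fun c hc => ⟨hc.2.1.1, hc.2.2⟩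
  obtain ⟨m, ⟨hm, hxm, hma⟩, hmin⟩ := hfin.exists_minimal ⟨a, ha, hxa, Q.le_refl a⟩
  refine ⟨m, hm, hxm, hma, fun q hq hxq hqm => hqm.2 ?_⟩
  exact Q.le_antisymm hqm.1 (hmin ⟨hq, hxq, Q.le_trans hqm.1 hma⟩ hqm.1)

theorem disjointHyp_star_comm {h k : P} :
    Q.disjointHyp (Q.star k) (Q.star h) ↔ Q.disjointHyp h k := by
  have key : Q.sameHyp (Q.star k) (Q.star h) ↔ Q.sameHyp h k := by
    have h1 := Q.star_star h
    have h2 := Q.star_star k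
    unfold sameHyp
    grind
  simp only [disjointHyp, transverse, key, orient_star]
  grind

theorem exists_lt_or_gt_of_disjointHyp {h k : P} (hd : Q.disjointHyp h k) :
    ∃ a ∈ Q.orient h, Q.lt a k ∨ Q.lt k a := by
  obtain ⟨hs, ht⟩ := hd
  have hne : ∀ a ∈ Q.orient h, a ≠ k := fun a ha e => hs (e ▸ ha)
  have hcomp : ∃ a ∈ Q.orient h, ∃ b ∈ Q.orient k, Q.le a b ∨ Q.le b a := by
    by_contra hcon
    exact ht ⟨hs, fun a ha b hb =>
      ⟨fun hle => hcon ⟨a, ha, b, hb, .inl hle⟩, fun hle => hcon ⟨a, ha, b, hb, .inr hle⟩⟩⟩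
  obtain ⟨a, ha, b, rfl | rfl, hle⟩ := hcomp
  · exact ⟨a, ha, hle.imp (fun hl => ⟨hl, hne a ha⟩) fun hl => ⟨hl, (hne a ha).symm⟩⟩
  · have ha' := star_mem_orient ha
    refine ⟨_, ha', hle.symm.imp (fun hl => ⟨?_, hne _ ha'⟩) fun hl => ⟨?_, (hne _ ha').symm⟩⟩ <;>
    simpa only [Q.star_star] using Q.star_antitone hl

theorem hypRel_of_mem {h m q : P} (hq : q ∈ Q.orient m) :
    Q.hypRel r h q ↔ Q.hypRel r h m := by
  rcases hq with rfl | rfl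
  · rfl
  · simp only [hypRel, Q.star_star]
    exact or_comm

namespace IsAdmissible

theorem rel_star_iff (hr : Q.IsAdmissible r) {h k : P} : r (Q.star h) k ↔ r h (Q.star k) := by
  constructor <;> intro hk <;> simpa only [Q.star_star] using hr.aer2 _ _ hk

theorem hypRel_star_left_s2 (hr : Q.IsAdmissible r) {h m : P} :
    Q.hypRel r (Q.star h) m ↔ Q.hypRel r h m := by
  simp only [hypRel, hr.rel_star_iff, Q.star_star]
  exact or_comm

theorem quotLT_star (hr : Q.IsAdmissible r) {h k : P} (hlt : Q.QuotLT r h k) :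
    Q.QuotLT r (Q.star k) (Q.star h) := by
  obtain ⟨hne, hdisj, hins⟩ := hlt
  refine ⟨fun e => hne ?_, fun k' h' hk hh => ?_, fun k' h' hk hh hsep => ?_⟩
  · simpa only [Q.star_star] using hr.rel_star_iff.1 (hr.equiv.symm e)
  · rw [hr.rel_star_iff] at hk hh
    simpa only [Q.star_star] using disjointHyp_star_comm.2 (hdisj _ _ hh hk)
  · rw [hr.rel_star_iff] at hk hh
    have := lt_star (hins _ _ hh hk fun m hm hs => hsep m ?_ ?_)
    · simpa only [Q.star_star] using this
    · simpa only [hr.hypRel_star_left_s2] using hm.symm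
    · simpa only [Q.star_star] using separates_star_comm.2 hs

end IsAdmissible

/-- If `[h] < [k]` and no hyperplane of `[k̂]` separates `ĥ` and `k̂`, then `ĥ` is contained
in the halfspace `k`. -/
theorem QuotLT.exists_orient_lt (hLF : Q.LocallyFinite) (hr : Q.IsAdmissible r) {h k : P}
    (hlt : Q.QuotLT r h k) (hsep : ∀ m, Q.hypRel r k m → ¬ Q.separates m h k) :
    ∃ a ∈ Q.orient h, Q.lt a k := by
  obtain ⟨-, hdisj, hins⟩ := hlt
  obtain ⟨a, ha, hak | hka⟩ :=
    exists_lt_or_gt_of_disjointHyp (hdisj h k (hr.equiv.refl h) (hr.equiv.refl k))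
  · exact ⟨a, ha, hak⟩
  have haS : Q.hypRel r h a := (hypRel_of_mem ha).2 (.inl (hr.equiv.refl h))
  obtain ⟨m, hm, hkm, hma, hmin⟩ := hLF.exists_minimal_gt (Q.hypRel r h) hka haS
  have hinsep : ∀ n, (Q.hypRel r h n ∨ Q.hypRel r k n) → ¬ Q.separates n m k := by
    intro n hn hs
    obtain ⟨q, hq, hkq, hqm⟩ := exists_between_of_separates hkm hs
    rcases hn with hn | hn
    · exact hmin q ((hypRel_of_mem hq).2 hn) hkq hqm
    · exact hsep n hn (separates_symm
        ⟨k, mem_orient_self k, q, hq, a, ha, hkq, lt_of_lt_of_le hqm hma⟩)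
  rcases hm with hm | hm
  · exact absurd hkm (not_lt_of_lt (hins m k hm (hr.equiv.refl k) hinsep))
  · have hmk := hins (Q.star m) k hm (hr.equiv.refl k) fun n hn hs =>
      hinsep n hn ((separates_of_mem (Or.inr rfl) (mem_orient_self k)).1 hs)
    exact absurd (lt_trans_s2 hmk hkm).1 (Q.not_star_le m)

end Pocset

/-- if `[h] < [k]` then: (i) if `ĥ`, `k̂` are `[k̂]`-inseparable
then some orientation of `ĥ` is strictly smaller than `k`; (ii) if `ĥ`, `k̂`
are `[ĥ]`-inseparable then some orientation of `k̂` is strictly smaller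
than `h*`. -/
theorem observation_quotLT {P : Type u} (Q : Pocset P) (hLF : Q.LocallyFinite)
    (r : P → P → Prop) (hr : Q.IsAdmissible r) (h k : P)
    (hlt : Q.QuotLT r h k) :
    ((∀ m, Q.hypRel r k m → ¬ Q.separates m h k) → ∃ a ∈ Q.orient h, Q.lt a k) ∧
    ((∀ m, Q.hypRel r h m → ¬ Q.separates m h k) →
      ∃ b ∈ Q.orient k, Q.lt b (Q.star h)) := by
  refine ⟨hlt.exists_orient_lt hLF hr, fun hsep => ?_⟩
  rw [← Pocset.orient_star k]
  exact (hr.quotLT_star hlt).exists_orient_lt hLF hr fun m hm hs =>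
    hsep m (hr.hypRel_star_left_s2.1 hm) (Pocset.separates_star_comm.1 hs)
end

section
/- Let P and P' be locally finite pocsets and let f : P → P' be a resolution of pocsets that is not an embedding of pocsets. Then there exist facing halfspaces h₁, h₂ ∈ P forming an elementary foldable pair for f, that is: f(h₁) = f(h₂), the hyperplanes ĥ₁, ĥ₂ are f⁻¹(f(ĥ₁))-inseparable, and no pair of distinct ∼_f-equivalent hyperplanes both separate ĥ₁ and ĥ₂. -/
/- Pocsets, hyperplanes, admissible equivalence relations, quotients,
   admissible maps, embeddings, resolutions, group actions on pocsets,
   elementary folds and folding sequences. -/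

universe u v w

namespace Pocset

variable {P : Type u} {P' : Type v}

theorem star_le_comm (Q : Pocset P) {a b : P} (h : Q.le (Q.star a) b) : Q.le (Q.star b) a := by
  simpa [Q.star_star] using Q.star_antitone h

theorem le_star_comm (Q : Pocset P) {a b : P} (h : Q.le a (Q.star b)) : Q.le b (Q.star a) := by
  simpa [Q.star_star] using Q.star_antitone h

theorem star_le_star (Q : Pocset P) {a b : P} (h : Q.le (Q.star a) (Q.star b)) : Q.le b a := by
  simpa [Q.star_star] using Q.star_antitone h

/-- If `a < b`, the hyperplanes separating `â` and `b̂` have an orientation strictly between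
`a` and `b`. -/
theorem separates.exists_between {Q : Pocset P} {a b m h k : P} (hab : Q.lt a b)
    (ha : a ∈ Q.orient h) (hb : b ∈ Q.orient k) (hs : Q.separates m h k) :
    ∃ c ∈ Q.orient m, Q.lt a c ∧ Q.lt c b := by
  have orient_cases : ∀ {x y z : P}, x ∈ Q.orient z → y ∈ Q.orient z → y = x ∨ y = Q.star x := by
    rintro x y z (rfl | rfl) (rfl | rfl) <;> simp [Q.star_star]
  obtain ⟨x, hx, c, hc, y, hy, hxc, hcy⟩ := hs
  have hxy : Q.le x y := Q.le_trans hxc.1 hcy.1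
  rcases orient_cases ha hx with rfl | rfl <;> rcases orient_cases hb hy with rfl | rfl
  · exact ⟨c, hc, hxc, hcy⟩
  · exact (Q.not_le_star _ (Q.le_trans hab.1 (Q.le_star_comm hxy))).elim
  · exact (Q.not_star_le _ (Q.le_trans (Q.star_le_comm hxy) hab.1)).elim
  · exact (hab.2 (Q.le_antisymm hab.1 (Q.star_le_star hxy))).elim

/-- Two halfspaces in a common interval whose hyperplanes are not transverse are comparable. -/
theorem le_total_of_mem_interval (Q : Pocset P) {a b c d : P} (hac : Q.le a c) (hcb : Q.le c b)
    (had : Q.le a d) (hdb : Q.le d b) (hcd : ¬ Q.transverse c d) : Q.le c d ∨ Q.le d c := by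
  have not_le_star : ¬ Q.le c (Q.star d) := fun h =>
    Q.not_le_star a (Q.le_trans hac (Q.le_trans h (Q.star_antitone had)))
  have not_star_le : ¬ Q.le (Q.star c) d := fun h =>
    Q.not_star_le b (Q.le_trans (Q.star_antitone hcb) (Q.le_trans h hdb))
  by_contra! hne
  refine hcd ⟨?_, ?_⟩
  · rintro (rfl | rfl)
    · exact hne.1 (Q.le_refl _)
    · exact not_star_le (Q.le_refl _)
  · rintro x (rfl | rfl) y (rfl | rfl)
    · exact hne
    · exact ⟨not_le_star, fun h => not_star_le (Q.star_le_comm h)⟩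
    · exact ⟨not_star_le, fun h => not_le_star (Q.le_star_comm h)⟩
    · exact ⟨fun h => hne.2 (Q.star_le_star h), fun h => hne.1 (Q.star_le_star h)⟩

theorem ncard_interval_lt {Q : Pocset P} (hLF : Q.LocallyFinite) {a b c d : P} (hab : Q.le a b)
    (hac : Q.le a c) (hdb : Q.le d b) (hne : a ≠ c ∨ d ≠ b) :
    {x | Q.le c x ∧ Q.le x d}.ncard < {x | Q.le a x ∧ Q.le x b}.ncard := by
  refine Set.ncard_lt_ncard ⟨fun x hx => ⟨Q.le_trans hac hx.1, Q.le_trans hx.2 hdb⟩, fun h => ?_⟩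
    (hLF a b)
  rcases hne with hne | hne
  · exact hne (Q.le_antisymm hac (h ⟨Q.le_refl a, hab⟩).1)
  · exact hne (Q.le_antisymm hdb (h ⟨hab, Q.le_refl b⟩).2)

/-- For injective `f` the quotient order on `P/∼_f` implies the order on `P`. -/
theorem QuotLT.lt_of_injective {Q : Pocset P} {f : P → P'} (hf : Function.Injective f) {h k : P}
    (hq : Q.QuotLT (simRel f) h k) : Q.lt h k := by
  have lt_orient : ∀ {x y z : P}, x ∈ Q.orient z → y ∈ Q.orient z → ¬ Q.lt x y := by
    rintro x y z (rfl | rfl) (rfl | rfl) h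
    exacts [h.2 rfl, Q.not_le_star _ h.1, Q.not_star_le _ h.1, h.2 rfl]
  have orient_of_hypRel : ∀ {m z : P}, Q.hypRel (simRel f) z m → Q.orient m = Q.orient z := by
    rintro m z (h | h) <;> obtain rfl := hf h
    · rfl
    · simp only [orient, Q.star_star]
      exact Set.pair_comm _ _
  refine hq.2.2 h k rfl rfl ?_
  rintro m (hm | hm) ⟨x, hx, c, hc, y, hy, hxc, hcy⟩ <;> rw [orient_of_hypRel hm] at hc
  · exact lt_orient hx hc hxc
  · exact lt_orient hc hy hcy

theorem IsResolution.not_injective {Q : Pocset P} {Q' : Pocset P'} {f : P → P'}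
    (hres : IsResolution Q Q' f) (hemb : ¬ IsPocsetEmbedding Q Q' f) :
    ¬ Function.Injective f := fun hf => hemb
  { adm := hres.adm
    inj := hf
    le_reflect := fun h k hle => (hres.le_reflect h k hle).elim
      (fun heq => hf heq ▸ Q.le_refl h) (fun hlt => (hlt.lt_of_injective hf).1) }

theorem sameHyp.symm {Q : Pocset P} {h k : P} (hs : Q.sameHyp h k) : Q.sameHyp k h := by
  rcases hs with rfl | rfl
  · exact Or.inl rfl
  · exact Or.inr (Q.star_star h).symm

theorem sameHyp.trans {Q : Pocset P} {h k l : P} (hs : Q.sameHyp h k) (hs' : Q.sameHyp k l) :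
    Q.sameHyp h l := by
  rcases hs with rfl | rfl
  · exact hs'
  · rcases hs' with rfl | rfl
    · exact Or.inr rfl
    · exact Or.inl (Q.star_star h)

theorem sameHyp_of_mem_orient {Q : Pocset P} {Q' : Pocset P'} {f : P → P'}
    (hf : IsAdmissibleMap Q Q' f) {c m : P} (hc : c ∈ Q.orient m) : Q'.sameHyp (f m) (f c) := by
  rcases hc with rfl | rfl
  · exact Or.inl rfl
  · exact Or.inr (hf.am1 m)

theorem hypRel_simRel {Q : Pocset P} {Q' : Pocset P'} {f : P → P'}
    (hf : IsAdmissibleMap Q Q' f) {h k : P} :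
    Q.hypRel (simRel f) h k ↔ Q'.sameHyp (f k) (f h) := by
  simp only [hypRel, simRel, sameHyp, hf.am1]

/-- Hyperplanes identified by an admissible map are not transverse. -/
theorem not_transverse_of_sameHyp {Q : Pocset P} {Q' : Pocset P'} {f : P → P'}
    (hf : IsAdmissibleMap Q Q' f) {h k : P} (hs : Q'.sameHyp (f h) (f k)) :
    ¬ Q.transverse h k := fun ht => (hf.am2 h k ht).1 hs

/-- A non-injective resolution identifies the hyperplanes of some `a < b`. -/
theorem IsResolution.exists_lt_sameHyp {Q : Pocset P} {Q' : Pocset P'} {f : P → P'}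
    (hres : IsResolution Q Q' f) (hinj : ¬ Function.Injective f) :
    ∃ a b, Q.lt a b ∧ Q'.sameHyp (f a) (f b) := by
  obtain ⟨h, k, hfe, hne⟩ := Function.not_injective_iff.mp hinj
  have hsame : ¬ Q.sameHyp h k := by
    rintro (rfl | rfl)
    exacts [hne rfl, hres.aer.aer1 h hfe]
  by_contra! hno
  have map_orient : ∀ a ∈ Q.orient h, ∀ b ∈ Q.orient k, Q'.sameHyp (f a) (f b) := fun a ha b hb =>
    ((sameHyp_of_mem_orient hres.adm ha).symm.trans (Or.inl hfe.symm)).trans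
      (sameHyp_of_mem_orient hres.adm hb)
  have orient_ne : ∀ a ∈ Q.orient h, ∀ b ∈ Q.orient k, a ≠ b := by
    rintro a (rfl | rfl) b (rfl | rfl) hab
    · exact hne hab
    · exact hsame (Or.inr (by rw [hab, Q.star_star]))
    · exact hsame (Or.inr hab.symm)
    · exact hne (by rw [← Q.star_star h, hab, Q.star_star])
  exact not_transverse_of_sameHyp hres.adm (Or.inl hfe.symm) ⟨hsame, fun a ha b hb =>
    ⟨fun hle => hno a b ⟨hle, orient_ne a ha b hb⟩ (map_orient a ha b hb),
      fun hle => hno b a ⟨hle, (orient_ne a ha b hb).symm⟩ (map_orient a ha b hb).symm⟩⟩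

/-- If `a < b` have `f`-equivalent hyperplanes and no proper subinterval of `[a, b]` has
`f`-equivalent endpoints, then `a*` and `b` form an elementary foldable pair. -/
theorem IsResolution.elemFoldable_of_minimal {Q : Pocset P} {Q' : Pocset P'} {f : P → P'}
    (hres : IsResolution Q Q' f) {a b : P} (hab : Q.lt a b) (hs : Q'.sameHyp (f a) (f b))
    (hmin : ∀ c d, Q.le a c → Q.le d b → Q.lt c d → Q'.sameHyp (f c) (f d) → a = c ∧ d = b) :
    Q.ElemFoldable Q' f (Q.star a) b := by
  have star_mem : Q.star a ∈ Q.orient a := Or.inr rfl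
  have mem_star : a ∈ Q.orient (Q.star a) := Or.inr (Q.star_star a).symm
  have mem_self : ∀ x, x ∈ Q.orient x := fun x => Or.inl rfl
  have hsa := sameHyp_of_mem_orient hres.adm star_mem
  have insep : ∀ h, a ∈ Q.orient h → ∀ m, Q'.sameHyp (f m) (f a) → ¬ Q.separates m h b := by
    intro h hah m hm hsep
    obtain ⟨c, hc, hac, hcb⟩ := hsep.exists_between hab hah (mem_self b)
    exact hcb.2 (hmin a c (Q.le_refl a) hcb.1 hac
      (hm.symm.trans (sameHyp_of_mem_orient hres.adm hc))).2
  have hfac : Q.facing (Q.star a) b := by rwa [facing, Q.star_star]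
  have hne : ¬ Q.sameHyp a b := by
    rintro (rfl | rfl)
    exacts [hab.2 rfl, Q.not_le_star a hab.1]
  refine ⟨hfac, ?_, fun m hm => insep _ mem_star m (hm.trans hsa.symm), ?_⟩
  · exact hres.aer.aer4 a b ((hypRel_simRel hres.adm).2 hs.symm) hne
      (fun m hm => insep a (mem_self a) m ((hypRel_simRel hres.adm).1 hm)) _ star_mem b
      (mem_self b) hfac
  · rintro m m' hmm' hne' ⟨hm, hm'⟩
    obtain ⟨c, hc, hac, hcb⟩ := hm.exists_between hab mem_star (mem_self b)
    obtain ⟨d, hd, had, hdb⟩ := hm'.exists_between hab mem_star (mem_self b)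
    have hcd : Q'.sameHyp (f c) (f d) :=
      ((sameHyp_of_mem_orient hres.adm hc).symm.trans hmm').trans
        (sameHyp_of_mem_orient hres.adm hd)
    have hcdne : c ≠ d := by
      rintro rfl
      exact hne' (sameHyp.trans (k := c) hc (sameHyp.symm hd))
    rcases Q.le_total_of_mem_interval hac.1 hcb.1 had.1 hdb.1
      (not_transverse_of_sameHyp hres.adm hcd) with hle | hle
    · exact hac.2 (hmin c d hac.1 hdb.1 ⟨hle, hcdne⟩ hcd).1
    · exact had.2 (hmin d c had.1 hcb.1 ⟨hle, hcdne.symm⟩ hcd.symm).1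

end Pocset

/-- a resolution of pocsets which is not an embedding of pocsets
admits an elementary foldable pair. -/
theorem exists_elementary_foldable_pair {P : Type u} {P' : Type v}
    (Q : Pocset P) (Q' : Pocset P')
    (hLF : Q.LocallyFinite) (hLF' : Q'.LocallyFinite)
    (f : P → P') (hres : Pocset.IsResolution Q Q' f)
    (hemb : ¬ Pocset.IsPocsetEmbedding Q Q' f) :
    ∃ h₁ h₂ : P, Pocset.ElemFoldable Q Q' f h₁ h₂ := by
  let S : Set (P × P) := {p | Q.lt p.1 p.2 ∧ Q'.sameHyp (f p.1) (f p.2)}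
  have hS : S.Nonempty := by
    obtain ⟨a, b, hab⟩ := hres.exists_lt_sameHyp (hres.not_injective hemb)
    exact ⟨(a, b), hab⟩
  obtain ⟨⟨a, b⟩, ⟨hab, hs⟩, hmin⟩ := (measure fun p : P × P =>
    {x | Q.le p.1 x ∧ Q.le x p.2}.ncard).wf.has_min S hS
  refine ⟨Q.star a, b, hres.elemFoldable_of_minimal hab hs fun c d hac hdb hcd hs' => ?_⟩
  by_contra hne
  exact hmin (c, d) ⟨hcd, hs'⟩
    (Pocset.ncard_interval_lt hLF hab.1 hac hdb (not_and_or.mp hne))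
end
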